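/- Let Φ ∈ ℝ^{M×N} have unit-norm columns (‖φ_i‖₂ = 1 for all i) and satisfy the restricted isometry property of order K with constant δ ∈ (0,1). Let x ∈ ℝ^N have support T with |T| = K ≥ 1 and suppose |x_t| = 1 for every t ∈ T (constant amplitude random sign signal). Let y = Φx. Then max_{t ∈ T} |⟨φ_t, y⟩| ≤ 1 + δ·√(K − 1). -/

import Mathlib

open Finset

/-- The Euclidean (ℓ²) norm of a vector in ℝⁿ. -/
noncomputable def l2norm {n : ℕ} (v : Fin n → ℝ) : ℝ := Real.sqrt (∑ i, v i ^ 2)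

/-- The Euclidean inner product on ℝᵐ. -/
noncomputable def dot {m : ℕ} (u v : Fin m → ℝ) : ℝ := ∑ k, u k * v k

/-- `x` has at most `s` nonzero entries. -/
noncomputable def sparse {n : ℕ} (s : ℕ) (x : Fin n → ℝ) : Prop :=
  (Finset.univ.filter (fun i => x i ≠ 0)).card ≤ s

/-- `Φ` satisfies the restricted isometry property of order `s` with constant `δ`. -/
noncomputable def RIP {M N : ℕ} (Φ : Matrix (Fin M) (Fin N) ℝ) (s : ℕ) (δ : ℝ) : Prop :=
  ∀ x : Fin N → ℝ, sparse s x →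
    (1 - δ) * l2norm x ^ 2 ≤ l2norm (Φ.mulVec x) ^ 2 ∧
    l2norm (Φ.mulVec x) ^ 2 ≤ (1 + δ) * l2norm x ^ 2

theorem l2norm_sq_eq {n : ℕ} (v : Fin n → ℝ) : l2norm v ^ 2 = ∑ i, v i ^ 2 :=
  Real.sq_sqrt (Finset.sum_nonneg fun i _ => sq_nonneg (v i))

theorem mulVec_update_aux {M N : ℕ} (Φ : Matrix (Fin M) (Fin N) ℝ) (x : Fin N → ℝ)
    (t : Fin N) (s : ℝ) (k : Fin M) :
    Φ.mulVec (Function.update x t s) k =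
      Φ k t * s + Φ.mulVec (Function.update x t 0) k := by
  simp only [Matrix.mulVec, dotProduct]
  rw [← Finset.add_sum_erase _ _ (Finset.mem_univ t),
    ← Finset.add_sum_erase (a := t) _ (fun i => Φ k i * Function.update x t 0 i) (Finset.mem_univ t)]
  simp only [Function.update_self, mul_zero, zero_add]
  congr 1
  apply Finset.sum_congr rfl
  intro i hi
  have : i ≠ t := Finset.ne_of_mem_erase hi
  simp [this]

/-- inequality (26), the CARS case: if `Φ` has unit-norm columns and
RIP of order `K` with constant `δ ∈ (0,1)`, `x` has support `T` with `|T| = K ≥ 1`,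
`|x t| = 1` for every `t ∈ T`, and `y = Φx`, then
`max_{t ∈ T} |⟨φ_t, y⟩| ≤ 1 + δ√(K−1)`. -/
theorem stmt_17 {M N : ℕ} (K : ℕ) (hK : 1 ≤ K)
    (Φ : Matrix (Fin M) (Fin N) ℝ)
    (hcols : ∀ i : Fin N, l2norm (fun k => Φ k i) = 1)
    (δ : ℝ) (hδ0 : 0 < δ) (hδ1 : δ < 1) (hRIP : RIP Φ K δ)
    (x : Fin N → ℝ) (T : Finset (Fin N))
    (hT : ∀ i, x i ≠ 0 ↔ i ∈ T) (hTcard : T.card = K)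
    (hCARS : ∀ t ∈ T, |x t| = 1)
    (y : Fin M → ℝ) (hy : y = Φ.mulVec x) :
    (⨆ t : T, |dot (fun k => Φ k (t : Fin N)) y|) ≤
      1 + δ * Real.sqrt ((K : ℝ) - 1) := by
  have hne : T.Nonempty := Finset.card_pos.mp (by omega)
  haveI : Nonempty T := hne.to_subtype
  apply ciSup_le
  rintro ⟨t, ht⟩
  simp only
  set z := Φ.mulVec (Function.update x t 0) with hz
  set c := ∑ k, Φ k t * z k with hc
  have hcol : ∑ k, Φ k t ^ 2 = 1 := by
    have h := l2norm_sq_eq (fun k => Φ k t)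
    rw [hcols t] at h
    linarith
  have hxsq : ∀ i ∈ T, x i ^ 2 = 1 := fun i hi => by
    rw [← sq_abs, hCARS i hi]; norm_num
  have hdot : dot (fun k => Φ k t) y = x t + c := by
    have hyk : ∀ k, y k = Φ k t * x t + z k := fun k => by
      rw [hy, hz, ← mulVec_update_aux, Function.update_eq_self]
    simp only [dot, hyk, hc]
    calc _ = ∑ k, (x t * Φ k t ^ 2 + Φ k t * z k) :=
          Finset.sum_congr rfl fun k _ => by ring
      _ = _ := by rw [Finset.sum_add_distrib, ← Finset.mul_sum, hcol, mul_one]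
  have hnorm : ∀ s : ℝ, l2norm (Function.update x t s) ^ 2 = s ^ 2 + ((K : ℝ) - 1) := by
    intro s
    rw [l2norm_sq_eq, ← Finset.add_sum_erase _ _ (Finset.mem_univ t), Function.update_self]
    congr 1
    have h1 : ∑ i ∈ Finset.univ.erase t, Function.update x t s i ^ 2
        = ∑ i ∈ Finset.univ.erase t, x i ^ 2 :=
      Finset.sum_congr rfl fun i hi => by
        rw [Function.update_of_ne (Finset.ne_of_mem_erase hi)]
    have h2 : ∑ i, x i ^ 2 = (K : ℝ) := by
      rw [← Finset.sum_subset (Finset.subset_univ T), Finset.sum_congr rfl hxsq]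
      · simp [hTcard]
      · intro i _ hi
        have : x i = 0 := by
          by_contra h
          exact hi ((hT i).1 h)
        simp [this]
    have h3 := Finset.add_sum_erase Finset.univ (fun i => x i ^ 2) (Finset.mem_univ t)
    simp only [hxsq t ht, h2] at h3
    rw [h1]; linarith
  have hsp : ∀ s : ℝ, sparse K (Function.update x t s) := by
    intro s
    rw [sparse, ← hTcard]
    apply Finset.card_le_card
    intro i hi
    by_cases h : i = t
    · exact h ▸ ht
    · rw [Finset.mem_filter, Function.update_of_ne h] at hi
      exact (hT i).1 hi.2
  have himg : ∀ s : ℝ, l2norm (Φ.mulVec (Function.update x t s)) ^ 2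
      = s ^ 2 + 2 * s * c + ∑ k, z k ^ 2 := by
    intro s
    rw [l2norm_sq_eq]
    calc _ = ∑ k, (s ^ 2 * Φ k t ^ 2 + 2 * s * (Φ k t * z k) + z k ^ 2) :=
          Finset.sum_congr rfl fun k _ => by rw [mulVec_update_aux]; ring
      _ = _ := by
        rw [Finset.sum_add_distrib, Finset.sum_add_distrib, ← Finset.mul_sum,
          ← Finset.mul_sum, hcol, mul_one]
  have key : ∀ s : ℝ, 2 * s * c ≤ δ * (s ^ 2 + ((K : ℝ) - 1)) := by
    intro s
    have h1 := (hRIP _ (hsp s)).2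
    have h2 := (hRIP _ (hsp (-s))).1
    rw [himg, hnorm] at h1 h2
    nlinarith
  have hc2 : c ^ 2 ≤ δ ^ 2 * ((K : ℝ) - 1) := by
    have h := mul_le_mul_of_nonneg_left (key (c / δ)) hδ0.le
    have e1 : δ * (2 * (c / δ) * c) = 2 * c ^ 2 := by field_simp
    have e2 : δ * (δ * ((c / δ) ^ 2 + ((K : ℝ) - 1))) = c ^ 2 + δ ^ 2 * ((K : ℝ) - 1) := by
      field_simp
    rw [e1, e2] at h
    linarith
  have hcabs : |c| ≤ δ * Real.sqrt ((K : ℝ) - 1) := by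
    have h := Real.abs_le_sqrt hc2
    rwa [Real.sqrt_mul (sq_nonneg δ), Real.sqrt_sq hδ0.le] at h
  rw [hdot]
  calc |x t + c| ≤ |x t| + |c| := abs_add_le _ _
    _ ≤ _ := by rw [hCARS t ht]; linarith
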